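/- Let H be a Hall universal group and let g ∈ Aut(H) be a generic automorphism, i.e., the conjugacy class { f g f⁻¹ : f ∈ Aut(H) } is comeager in Aut(H). Then for every integer n ≠ 0, g is conjugate in Aut(H) to gⁿ, and moreover there exists a group homomorphism φ : (ℚ, +) → Aut(H) with φ(1) = g. -/

import Mathlib

/-- A group `H` is a *Hall universal group* if it is countable, locally finite,
every finite group embeds into it, and any two isomorphic finite subgroups are
conjugate in `H`.  (Philip Hall's universal locally finite group is the unique
such group up to isomorphism.) -/
structure IsHallUniversal (H : Type*) [Group H] : Prop where
  /-- `H` is countable. -/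
  countable : Countable H
  /-- `H` is locally finite: every finitely generated subgroup is finite. -/
  locallyFinite : ∀ S : Subgroup H, S.FG → Finite S
  /-- Every finite group embeds into `H`. -/
  embedsFinite : ∀ (G : Type) [Group G] [Finite G], ∃ f : G →* H, Function.Injective f
  /-- Any two isomorphic finite subgroups of `H` are conjugate in `H`. -/
  conjIso : ∀ A B : Subgroup H, Finite A → Finite B → Nonempty (A ≃* B) →
    ∃ h : H, Subgroup.map (MulAut.conj h).toMonoidHom A = B

/-- The topology of pointwise convergence on `Aut H`: the topology induced by viewing an
automorphism `f` as the function `f : H → H` in the product space `H → H`, where `H`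
carries the discrete topology. -/
instance hallAutTopology (H : Type*) [Group H] : TopologicalSpace (MulAut H) :=
  letI : TopologicalSpace H := ⊥
  TopologicalSpace.induced (fun f : MulAut H => (f : H → H)) Pi.topologicalSpace

namespace HallGeneric

set_option linter.style.haveILetI false

section Top

variable {H : Type*} [Group H]

lemma isOpen_eval (x a : H) : IsOpen {f : MulAut H | f x = a} := by
  letI : TopologicalSpace H := ⊥
  haveI : DiscreteTopology H := ⟨rfl⟩
  refine isOpen_induced_iff.2 ⟨{k : H → H | k x = a}, ?_, rfl⟩
  exact (isOpen_discrete ({a} : Set H)).preimage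
    (continuous_apply x : Continuous fun k : H → H => k x)

lemma continuous_of_eval {X : Type*} [TopologicalSpace X] (F : X → MulAut H)
    (h : ∀ x a, IsOpen {y | F y x = a}) : Continuous F := by
  letI : TopologicalSpace H := ⊥
  haveI : DiscreteTopology H := ⟨rfl⟩
  refine continuous_induced_rng.2 (continuous_pi fun x => ?_)
  refine continuous_discrete_rng.2 fun a => ?_
  exact h x a

lemma exists_finset {U : Set (MulAut H)} (hU : IsOpen U) {f : MulAut H} (hf : f ∈ U) :
    ∃ S : Finset H, ∀ k : MulAut H, (∀ x ∈ S, k x = f x) → k ∈ U := by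
  letI : TopologicalSpace H := ⊥
  haveI : DiscreteTopology H := ⟨rfl⟩
  obtain ⟨V, hV, rfl⟩ := isOpen_induced_iff.1 hU
  obtain ⟨I, u, hu, hI⟩ := isOpen_pi_iff.1 hV _ hf
  refine ⟨I, fun k hk => hI ?_⟩
  intro x hx
  show k x ∈ u x
  rw [hk x hx]
  exact (hu x hx).2

lemma continuous_mul' : Continuous (fun p : MulAut H × MulAut H => p.1 * p.2) := by
  refine continuous_of_eval _ fun x a => ?_
  have : {y : MulAut H × MulAut H | (y.1 * y.2) x = a} =
      ⋃ b : H, ({y | y.2 x = b} ∩ {y | y.1 b = a}) := by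
    ext y; simp
  rw [this]
  exact isOpen_iUnion fun b => ((isOpen_eval x b).preimage continuous_snd).inter
    ((isOpen_eval b a).preimage continuous_fst)

lemma continuous_inv' : Continuous (fun f : MulAut H => f⁻¹) := by
  refine continuous_of_eval _ fun x a => ?_
  have : {y : MulAut H | y⁻¹ x = a} = {y | y a = x} := by
    ext y
    constructor
    · rintro rfl; simp
    · rintro rfl; simp
  rw [this]
  exact isOpen_eval a x

lemma continuous_zpow' (n : ℤ) : Continuous (fun f : MulAut H => f ^ n) := by
  haveI : ContinuousMul (MulAut H) := ⟨continuous_mul'⟩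
  haveI : ContinuousInv (MulAut H) := ⟨continuous_inv'⟩
  haveI : IsTopologicalGroup (MulAut H) := {}
  exact continuous_zpow n

lemma baire [Countable H] : BaireSpace (MulAut H) := by
  letI : TopologicalSpace H := ⊥
  haveI : DiscreteTopology H := ⟨rfl⟩
  let e : MulAut H → (H → H) × (H → H) := fun f => (f, (f⁻¹ : MulAut H))
  have hind : Continuous (fun f : MulAut H => (f : H → H)) := continuous_induced_dom
  have hce : Continuous e := hind.prodMk (hind.comp continuous_inv')
  have hcl : Topology.IsClosedEmbedding e := by
    refine ⟨⟨?_, ?_⟩, ?_⟩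
    · refine Topology.IsInducing.of_comp hce continuous_fst ⟨rfl⟩
    · intro f k h
      exact DFunLike.coe_injective (congrArg Prod.fst h)
    · have : Set.range e = {p : (H → H) × (H → H) | (∀ x, p.1 (p.2 x) = x) ∧
          (∀ x, p.2 (p.1 x) = x) ∧ ∀ x y, p.1 (x * y) = p.1 x * p.1 y} := by
        ext p
        constructor
        · rintro ⟨f, rfl⟩
          exact ⟨fun x => by simp [e], fun x => by simp [e], fun x y => by simp [e]⟩
        · rintro ⟨h1, h2, h3⟩
          refine ⟨{ toFun := p.1, invFun := p.2, left_inv := h2, right_inv := h1,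
                    map_mul' := h3 }, ?_⟩
          rfl
      rw [this]
      have ev1 : ∀ x : H, Continuous fun p : (H → H) × (H → H) => p.1 x :=
        fun x => (continuous_apply x).comp continuous_fst
      have ev2 : ∀ x : H, Continuous fun p : (H → H) × (H → H) => p.2 x :=
        fun x => (continuous_apply x).comp continuous_snd
      have ev1' : ∀ x : H, Continuous fun p : (H → H) × H => p.1 x :=
        fun x => (continuous_apply x).comp continuous_fst
      have hev : Continuous fun q : (H → H) × H => q.1 q.2 := by
        refine continuous_discrete_rng.2 fun a => ?_
        have : (fun q : (H → H) × H => q.1 q.2) ⁻¹' {a} =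
            ⋃ b : H, ({q | q.2 = b} ∩ {q | q.1 b = a}) := by
          ext q; simp
        rw [this]
        exact isOpen_iUnion fun b => ((isOpen_discrete {b}).preimage continuous_snd).inter
          ((isOpen_discrete ({a} : Set H)).preimage (ev1' b))
      simp only [Set.ofPred_and, Set.ofPred_forall]
      refine IsClosed.inter ?_ (IsClosed.inter ?_ ?_)
      · exact isClosed_iInter fun x => isClosed_eq
          (hev.comp (continuous_fst.prodMk (ev2 x))) continuous_const
      · exact isClosed_iInter fun x => isClosed_eq
          (hev.comp (continuous_snd.prodMk (ev1 x))) continuous_const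
      · exact isClosed_iInter fun x => isClosed_iInter fun y => isClosed_eq
          (ev1 _) ((continuous_of_discreteTopology (f := fun q : H × H => q.1 * q.2)).comp
            ((ev1 x).prodMk (ev1 y)))
  haveI : PolishSpace H := inferInstance
  haveI : PolishSpace (MulAut H) := hcl.polishSpace
  letI := TopologicalSpace.upgradeIsCompletelyMetrizable (MulAut H)
  infer_instance

end Top

section Alg

variable {H : Type*} [Group H]

lemma embeds (hH : IsHallUniversal H) (K : Type*) [Group K] [Finite K] :
    ∃ f : K →* H, Function.Injective f := by
  obtain ⟨n, ⟨e⟩⟩ := Finite.exists_equiv_fin K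
  obtain ⟨f, hf⟩ := hH.embedsFinite (Equiv.Perm (Fin n))
  exact ⟨(f.comp e.permCongrHom.toMonoidHom).comp (MulAction.toPermHom K K),
    (hf.comp e.permCongrHom.injective).comp MulAction.toPerm_injective⟩

lemma conj_hol (hH : IsHallUniversal H) {K : Type*} [Group K] [Finite K]
    (e : K ⋊[MonoidHom.id (MulAut K)] (MulAut K) →* H) (he : Function.Injective e)
    (i : K →* H) (hi : Function.Injective i) :
    ∃ h : H, ∀ k, h * i k * h⁻¹ = e (SemidirectProduct.inl k) := by
  let j : K →* H := e.comp SemidirectProduct.inl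
  have hj : Function.Injective j := he.comp SemidirectProduct.inl_injective
  let ei := MonoidHom.ofInjective hi
  let ej := MonoidHom.ofInjective hj
  obtain ⟨a, ha⟩ := hH.conjIso i.range j.range (Finite.of_equiv K ei.toEquiv)
    (Finite.of_equiv K ej.toEquiv) ⟨ei.symm.trans ej⟩
  let α₀ : K →* j.range :=
    (((MulAut.conj a).toMonoidHom.comp i).codRestrict j.range (fun k => by
      rw [← ha]; exact ⟨i k, ⟨k, rfl⟩, rfl⟩))
  let α₁ : K →* K := ej.symm.toMonoidHom.comp α₀
  have h0 : ∀ k, j (α₁ k) = a * i k * a⁻¹ := by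
    intro k
    have : (ej (α₁ k) : H) = α₀ k := by
      show ((ej (ej.symm (α₀ k))) : H) = α₀ k
      rw [MulEquiv.apply_symm_apply]
    exact this
  have hinj : Function.Injective α₁ := by
    intro x y hxy
    have := congrArg j hxy
    rw [h0, h0] at this
    exact hi (by simpa using this)
  let α : MulAut K := MulEquiv.ofBijective α₁ (Finite.injective_iff_bijective.1 hinj)
  have h1 : ∀ k, e (SemidirectProduct.inr α) * e (SemidirectProduct.inl k)
      * (e (SemidirectProduct.inr α))⁻¹ = a * i k * a⁻¹ := by
    intro k
    rw [← h0 k]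
    show _ = e (SemidirectProduct.inl (α k))
    have := SemidirectProduct.inl_aut (φ := MonoidHom.id (MulAut K)) α k
    simp only [MonoidHom.id_apply] at this
    rw [this]
    simp
  refine ⟨(e (SemidirectProduct.inr α))⁻¹ * a, fun k => ?_⟩
  have := h1 k
  calc (e (SemidirectProduct.inr α))⁻¹ * a * i k * ((e (SemidirectProduct.inr α))⁻¹ * a)⁻¹
      = (e (SemidirectProduct.inr α))⁻¹ * (a * i k * a⁻¹) * e (SemidirectProduct.inr α) := by
        group
    _ = _ := by rw [← this]; group

lemma homog (hH : IsHallUniversal H) {K : Type*} [Group K] [Finite K]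
    (i j : K →* H) (hi : Function.Injective i) (hj : Function.Injective j) :
    ∃ h : H, ∀ k, h * i k * h⁻¹ = j k := by
  haveI : Finite (MulAut K) := Finite.of_injective (fun f : MulAut K => (f : K → K))
    DFunLike.coe_injective
  haveI : Finite (K ⋊[MonoidHom.id (MulAut K)] (MulAut K)) :=
    Finite.of_equiv _ SemidirectProduct.equivProd.symm
  obtain ⟨e, he⟩ := embeds hH (K ⋊[MonoidHom.id (MulAut K)] (MulAut K))
  obtain ⟨a, ha⟩ := conj_hol hH e he i hi
  obtain ⟨b, hb⟩ := conj_hol hH e he j hj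
  refine ⟨b⁻¹ * a, fun k => ?_⟩
  have : a * i k * a⁻¹ = b * j k * b⁻¹ := (ha k).trans (hb k).symm
  calc b⁻¹ * a * i k * (b⁻¹ * a)⁻¹ = b⁻¹ * (a * i k * a⁻¹) * b := by group
    _ = j k := by rw [this]; group

lemma finite_closure (hH : IsHallUniversal H) (S : Finset H) :
    Finite (Subgroup.closure (S : Set H)) :=
  hH.locallyFinite _ ⟨S, rfl⟩

lemma inner_dense (hH : IsHallUniversal H) (f : MulAut H) (S : Finset H) :
    ∃ c : H, ∀ x ∈ S, MulAut.conj c x = f x := by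
  haveI := finite_closure hH S
  obtain ⟨c, hc⟩ := homog hH (Subgroup.closure (S : Set H)).subtype
    (f.toMonoidHom.comp (Subgroup.closure (S : Set H)).subtype)
    (Subgroup.subtype_injective _) (f.injective.comp (Subgroup.subtype_injective _))
  exact ⟨c, fun x hx => hc ⟨x, Subgroup.subset_closure hx⟩⟩

lemma root_nat (hH : IsHallUniversal H) (S : Finset H) (z : H) (hz : ∀ x ∈ S, x * z = z * x)
    (n : ℕ) (hn : 0 < n) : ∃ w : H, (∀ x ∈ S, x * w = w * x) ∧ w ^ n = z := by
  classical
  let T : Finset H := insert z S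
  let E := Subgroup.closure (T : Set H)
  haveI : Finite E := finite_closure hH T
  have hzE : z ∈ E := Subgroup.subset_closure (by simp [T])
  have hzc : ∀ x ∈ E, x * z = z * x := by
    intro x hx
    have : E ≤ Subgroup.centralizer {z} := by
      refine (Subgroup.closure_le _).2 ?_
      intro y hy
      simp only [T, Finset.coe_insert, Set.mem_insert_iff, Finset.mem_coe] at hy
      rw [SetLike.mem_coe, Subgroup.mem_centralizer_singleton_iff]
      rcases hy with rfl | hy
      · rfl
      · first | exact hz y hy | exact (hz y hy).symm
    have h := this hx
    rw [Subgroup.mem_centralizer_singleton_iff] at h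
    first | exact h | exact h.symm
  let zE : E := ⟨z, hzE⟩
  let M := orderOf zE
  have hM : 0 < M := orderOf_pos zE
  haveI : NeZero (n * M) := ⟨(Nat.mul_pos hn hM).ne'⟩
  let C := Multiplicative (ZMod (n * M))
  let p : E × C := (zE, Multiplicative.ofAdd (-(n : ZMod (n * M))))
  let N := Subgroup.zpowers p
  have hpc : ∀ q : E × C, q * p = p * q := by
    intro q
    refine Prod.ext (Subtype.ext (hzc _ q.1.2)) (mul_comm _ _)
  haveI : N.Normal := by
    refine ⟨fun x hx q => ?_⟩
    obtain ⟨k, rfl⟩ := hx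
    have : Commute q (p ^ k) := Commute.zpow_right (hpc q) k
    refine ⟨k, ?_⟩
    show p ^ k = q * p ^ k * q⁻¹
    rw [this.eq, mul_inv_cancel_right]
  haveI : Finite C := inferInstanceAs (Finite (ZMod (n * M)))
  let i : E →* (E × C) ⧸ N := (QuotientGroup.mk' N).comp (MonoidHom.inl E C)
  have hi : Function.Injective i := by
    rw [injective_iff_map_eq_one]
    intro x hx
    have hx' : ((x, 1) : E × C) ∈ N := (QuotientGroup.eq_one_iff _).1 hx
    obtain ⟨k, hk⟩ := hx'
    have h1 : zE ^ k = x := congrArg Prod.fst hk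
    have h2 : (Multiplicative.ofAdd (-(n : ZMod (n * M)))) ^ k = 1 := congrArg Prod.snd hk
    rw [← ofAdd_zsmul] at h2
    have h3 : k • (-(n : ZMod (n * M))) = 0 := h2
    have h4 : ((k * n : ℤ) : ZMod (n * M)) = 0 := by
      have := congrArg Neg.neg h3
      push_cast
      simpa using this
    rw [ZMod.intCast_zmod_eq_zero_iff_dvd] at h4
    have h5 : (M : ℤ) ∣ k := by
      push_cast at h4
      rw [mul_comm k] at h4
      exact Int.dvd_of_mul_dvd_mul_left (by exact_mod_cast hn.ne') h4
    rw [← h1]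
    exact orderOf_dvd_iff_zpow_eq_one.1 h5
  let w₀ : (E × C) ⧸ N := QuotientGroup.mk' N (1, Multiplicative.ofAdd 1)
  have hw₀ : w₀ ^ n = i zE := by
    show (QuotientGroup.mk' N (1, Multiplicative.ofAdd 1)) ^ n = QuotientGroup.mk' N (zE, 1)
    rw [← map_pow]
    refine QuotientGroup.eq.2 ?_
    refine ⟨1, ?_⟩
    refine Prod.ext ?_ ?_
    · simp [p]
    · show (Multiplicative.ofAdd (-(n : ZMod (n * M)))) ^ (1:ℤ) =
        ((Multiplicative.ofAdd (1 : ZMod (n * M))) ^ n)⁻¹ * 1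
      rw [← ofAdd_nsmul]
      simp
  have hwc : ∀ x : E, i x * w₀ = w₀ * i x := by
    intro x
    show QuotientGroup.mk' N (x, 1) * QuotientGroup.mk' N (1, Multiplicative.ofAdd 1) =
      QuotientGroup.mk' N (1, Multiplicative.ofAdd 1) * QuotientGroup.mk' N (x, 1)
    rw [← map_mul, ← map_mul]
    simp
  obtain ⟨e, he⟩ := embeds hH ((E × C) ⧸ N)
  obtain ⟨h, hh⟩ := homog hH (e.comp i) E.subtype (he.comp hi) (Subgroup.subtype_injective _)
  have hh' : ∀ k : E, MulAut.conj h (e (i k)) = k := hh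
  refine ⟨MulAut.conj h (e w₀), fun x hx => ?_, ?_⟩
  · have hxE : x ∈ E := Subgroup.subset_closure (by simp [T, hx])
    have := hh' ⟨x, hxE⟩
    simp only at this
    rw [← this, ← map_mul, ← map_mul, ← map_mul, ← map_mul, hwc]
  · rw [← map_pow, ← map_pow, hw₀, hh']

lemma root_int (hH : IsHallUniversal H) (S : Finset H) (z : H) (hz : ∀ x ∈ S, x * z = z * x)
    (n : ℤ) (hn : n ≠ 0) : ∃ w : H, (∀ x ∈ S, x * w = w * x) ∧ w ^ n = z := by
  obtain ⟨w, hw, hwn⟩ := root_nat hH S z hz n.natAbs (Int.natAbs_pos.2 hn)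
  rcases Int.natAbs_eq n with h | h
  · refine ⟨w, hw, ?_⟩
    rw [h, zpow_natCast, hwn]
  · refine ⟨w⁻¹, fun x hx => (Commute.inv_right (hw x hx)).eq, ?_⟩
    rw [h, zpow_neg, zpow_natCast, inv_pow, inv_inv, hwn]

lemma dense_pow (hH : IsHallUniversal H) (n : ℤ) (hn : n ≠ 0) {D : Set (MulAut H)}
    (hDo : IsOpen D) (hDd : Dense D) : Dense ((fun f : MulAut H => f ^ n) ⁻¹' D) := by
  classical
  rw [dense_iff_inter_open]
  rintro U hU ⟨f₀, hf₀⟩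
  obtain ⟨S, hS⟩ := exists_finset hU hf₀
  obtain ⟨c, hc⟩ := inner_dense hH f₀ S
  let A : Finset H := insert c S
  let V : Set (MulAut H) := ⋂ x ∈ A, {f | f x = MulAut.conj (c ^ n) x}
  have hV : IsOpen V := isOpen_biInter_finset fun x _ => isOpen_eval _ _
  obtain ⟨f₁, hf₁V, hf₁D⟩ := hDd.inter_open_nonempty V hV
    ⟨MulAut.conj (c ^ n), by simp [V]⟩
  obtain ⟨T, hT⟩ := exists_finset hDo hf₁D
  obtain ⟨d, hd⟩ := inner_dense hH f₁ (T ∪ A)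
  have hdA : ∀ x ∈ A, d * x * d⁻¹ = c ^ n * x * (c ^ n)⁻¹ := by
    intro x hx
    have h1 := hd x (Finset.mem_union_right _ hx)
    have h2 : f₁ x = MulAut.conj (c ^ n) x := by
      simp only [V, Set.mem_iInter] at hf₁V
      exact hf₁V x hx
    exact h1.trans h2
  obtain ⟨w, hw, hwn⟩ := root_int hH A ((c ^ n)⁻¹ * d) (fun x hx => by
    have := hdA x hx
    have h2 : d * x = c ^ n * x * (c ^ n)⁻¹ * d := by rw [← this]; group
    rw [mul_assoc (c ^ n)⁻¹ d x, h2]; group) n hn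
  have hcw : Commute c w := hw c (by simp [A])
  refine ⟨MulAut.conj (c * w), hS _ fun x hx => ?_, ?_⟩
  · rw [← hc x hx]
    have := hw x (by simp [A, hx])
    simp only [MulAut.conj_apply]
    calc c * w * x * (c * w)⁻¹ = c * (w * x) * w⁻¹ * c⁻¹ := by group
      _ = c * x * c⁻¹ := by rw [← this]; group
  · show (MulAut.conj (c * w)) ^ n ∈ D
    rw [← map_zpow, hcw.mul_zpow, hwn, mul_inv_cancel_left]
    exact hT _ fun x hx => hd x (Finset.mem_union_left _ hx)

lemma residual_pow (hH : IsHallUniversal H) (n : ℤ) (hn : n ≠ 0) {C : Set (MulAut H)}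
    (hC : C ∈ residual (MulAut H)) :
    (fun f : MulAut H => f ^ n) ⁻¹' C ∈ residual (MulAut H) := by
  obtain ⟨S, hSo, hSd, hSc, hS⟩ := mem_residual_iff.1 hC
  have : (⋂ t ∈ S, (fun f : MulAut H => f ^ n) ⁻¹' t) ∈ residual (MulAut H) :=
    (countable_bInter_mem hSc).2 fun t ht =>
      residual_of_dense_open ((hSo t ht).preimage (continuous_zpow' n))
        (dense_pow hH n hn (hSo t ht) (hSd t ht))
  refine Filter.mem_of_superset this fun f hf => hS ?_
  simpa using hf

lemma conj_pow (hH : IsHallUniversal H) (g : MulAut H)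
    (hg : {h : MulAut H | ∃ f : MulAut H, h = f * g * f⁻¹} ∈ residual (MulAut H))
    (n : ℤ) (hn : n ≠ 0) : ∃ f : MulAut H, f * g * f⁻¹ = g ^ n := by
  haveI := hH.countable
  haveI := baire (H := H)
  obtain ⟨k, ⟨a, ha⟩, ⟨b, hb⟩⟩ :=
    (dense_of_mem_residual (Filter.inter_mem hg (residual_pow hH n hn hg))).nonempty
  have hb' : k ^ n = b * g * b⁻¹ := hb
  rw [ha, conj_zpow] at hb'
  refine ⟨a⁻¹ * b, ?_⟩
  calc a⁻¹ * b * g * (a⁻¹ * b)⁻¹ = a⁻¹ * (b * g * b⁻¹) * a := by group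
    _ = g ^ n := by rw [← hb']; group

end Alg

lemma flow {G : Type*} [Group G] (g : G) (r : ℕ → G) (h0 : r 0 = g)
    (hr : ∀ k, r (k + 1) ^ (k + 1) = r k) :
    ∃ φ : Multiplicative ℚ →* G, φ (Multiplicative.ofAdd (1 : ℚ)) = g := by
  have key : ∀ (k l : ℕ), ∀ a b : ℤ, (a : ℚ) / k.factorial = b / (k + l).factorial →
      r k ^ a = r (k + l) ^ b := by
    intro k l
    induction l with
    | zero =>
      intro a b h
      have : (k.factorial : ℚ) ≠ 0 := by exact_mod_cast k.factorial_ne_zero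
      simp only [add_zero] at h ⊢
      rw [div_left_inj' this] at h
      rw [Int.cast_injective h]
    | succ l ih =>
      intro a b h
      have h1 : (k.factorial : ℚ) ≠ 0 := by exact_mod_cast k.factorial_ne_zero
      have h2 : ((k + l).factorial : ℚ) ≠ 0 := by exact_mod_cast (k + l).factorial_ne_zero
      have hd : k.factorial ∣ (k + l).factorial := Nat.factorial_dvd_factorial (by omega)
      obtain ⟨m, hm⟩ := hd
      have h3 : (m : ℚ) ≠ 0 := by
        rintro h
        rw [hm] at h2; push_cast at h2; simp [h] at h2
      have e1 := ih a (a * m) (by rw [hm]; push_cast; field_simp)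
      rw [e1, ← hr (k + l), ← zpow_natCast, ← zpow_mul]
      congr 1
      have h4 : ((k : ℚ) + l + 1) ≠ 0 := by positivity
      have : (((k + l + 1 : ℕ) * (a * m) : ℤ) : ℚ) = b := by
        rw [← add_assoc, Nat.factorial_succ, hm] at h
        push_cast at h ⊢
        field_simp at h
        linear_combination h
      exact_mod_cast this
  have key2 : ∀ (k l : ℕ), ∀ a b : ℤ, (a : ℚ) / k.factorial = b / l.factorial →
      r k ^ a = r l ^ b := by
    intro k l a b h
    rcases le_total k l with hkl | hkl
    · obtain ⟨m, rfl⟩ := Nat.exists_eq_add_of_le hkl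
      exact key k m a b h
    · obtain ⟨m, rfl⟩ := Nat.exists_eq_add_of_le hkl
      exact (key l m b a h.symm).symm
  have ex : ∀ q : ℚ, ∀ N, q.den ≤ N → ∃ a : ℤ, (a : ℚ) / N.factorial = q := by
    intro q N hN
    obtain ⟨m, hm⟩ := Nat.dvd_factorial q.den_pos hN
    have h1 : (N.factorial : ℚ) ≠ 0 := by exact_mod_cast N.factorial_ne_zero
    refine ⟨q.num * m, ?_⟩
    rw [div_eq_iff h1, hm]
    push_cast
    rw [← mul_assoc, Rat.mul_den_eq_num]
  choose A hA using fun q : ℚ => ex q q.den le_rfl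
  let F : ℚ → G := fun q => r q.den ^ A q
  have hF : ∀ (q : ℚ) (N : ℕ) (a : ℤ), (a : ℚ) / N.factorial = q → F q = r N ^ a :=
    fun q N a h => key2 _ _ _ _ ((hA q).trans h.symm)
  refine ⟨MonoidHom.mk' (fun q => F q.toAdd) ?_, ?_⟩
  · intro x y
    obtain ⟨a, ha⟩ := ex x.toAdd (max x.toAdd.den y.toAdd.den) (le_max_left _ _)
    obtain ⟨b, hb⟩ := ex y.toAdd (max x.toAdd.den y.toAdd.den) (le_max_right _ _)
    show F (x.toAdd + y.toAdd) = F x.toAdd * F y.toAdd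
    rw [hF _ _ _ ha, hF _ _ _ hb, ← zpow_add]
    refine hF _ _ _ ?_
    push_cast
    rw [add_div, ha, hb]
  · show F 1 = g
    rw [hF 1 0 1 (by simp), h0, zpow_one]

end HallGeneric

/-- **Every generic automorphism `g` of a Hall universal group is conjugate to `gⁿ` for
every integer `n ≠ 0`, and there is an action of `(ℚ, +)` on `H` by automorphisms such
that `g` is the action of `1 ∈ ℚ`** (expressed as a group homomorphism from the
multiplicative version of `(ℚ, +)` into `Aut H` sending `1` to `g`). -/
theorem hallUniversal_generic_conjugate_to_all_powers_and_rational_flow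
    (H : Type*) [Group H] (hH : IsHallUniversal H) (g : MulAut H)
    (hg : {h : MulAut H | ∃ f : MulAut H, h = f * g * f⁻¹} ∈ residual (MulAut H)) :
    (∀ n : ℤ, n ≠ 0 → ∃ f : MulAut H, f * g * f⁻¹ = g ^ n) ∧
      ∃ φ : Multiplicative ℚ →* MulAut H, φ (Multiplicative.ofAdd (1 : ℚ)) = g := by
  refine ⟨HallGeneric.conj_pow hH g hg, ?_⟩
  have step : ∀ (k : ℕ) (x : MulAut H), (∃ f : MulAut H, x = f * g * f⁻¹) →
      ∃ y : MulAut H, (∃ f : MulAut H, y = f * g * f⁻¹) ∧ y ^ (k + 1) = x := by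
    rintro k x ⟨f, rfl⟩
    obtain ⟨a, ha⟩ := HallGeneric.conj_pow hH g hg ((k + 1 : ℕ) : ℤ) (by positivity)
    rw [zpow_natCast] at ha
    refine ⟨(f * a⁻¹) * g * (f * a⁻¹)⁻¹, ⟨_, rfl⟩, ?_⟩
    rw [conj_pow, ← ha]
    group
  choose! Y hY1 hY2 using step
  let r : ℕ → MulAut H := fun k => Nat.rec g (fun k x => Y k x) k
  have hr : ∀ k, ∃ f : MulAut H, r k = f * g * f⁻¹ := by
    intro k
    induction k with
    | zero => exact ⟨1, by simp [r]⟩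
    | succ k ih => exact hY1 k _ ih
  exact HallGeneric.flow g r rfl fun k => hY2 k _ (hr k)
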